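/- Let ℋ : ℝ³ → ℝ be smooth, compactly supported with supp ℋ ⊂ U, and axisymmetric, and let v : ℝ³ → ℝ³ be a smooth vector field with v_θ = v·e_θ. Then Σ_{i=1}^{2} ∫_{ℝ³} ℋ(x) · ∂_{x_i}((1/r)∂_θ v_θ)(x) · ∂_{x_i}ℋ(x) dx = 0. (Neither of the two summands need vanish individually, but their sum does.) -/

import Mathlib

open MeasureTheory

noncomputable section

abbrev R3 : Type := Fin 3 → ℝ

/-- cylindrical radius `r(x) = √(x₁² + x₂²)` -/
def rr (x : R3) : ℝ := Real.sqrt (x 0 ^ 2 + x 1 ^ 2)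

/-- the region off the symmetry axis -/
def U : Set R3 := {x | 0 < rr x}

/-- partial derivative in coordinate direction `i` -/
def pd (i : Fin 3) (u : R3 → ℝ) : R3 → ℝ := fun x => fderiv ℝ u x (Pi.single i 1)

/-- angular derivative `∂_θ u = x₁ ∂₂ u − x₂ ∂₁ u` -/
def dTheta (u : R3 → ℝ) : R3 → ℝ := fun x => x 0 * pd 1 u x - x 1 * pd 0 u x

/-- radial derivative `∂_r u = (x₁ ∂₁ u + x₂ ∂₂ u)/r` -/
def dR (u : R3 → ℝ) : R3 → ℝ := fun x => (x 0 * pd 0 u x + x 1 * pd 1 u x) / rr x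

/-- vertical derivative `∂_z` -/
def dZ (u : R3 → ℝ) : R3 → ℝ := pd 2 u

/-- the operator `(1/r)∂_r` -/
def dRr (u : R3 → ℝ) : R3 → ℝ := fun x => dR u x / rr x

/-- axisymmetric: `∂_θ f = 0` on `U` -/
def axisym (f : R3 → ℝ) : Prop := ∀ x ∈ U, dTheta f x = 0

/-- radial unit vector -/
def er (x : R3) : R3 := ![x 0 / rr x, x 1 / rr x, 0]
/-- azimuthal unit vector -/
def etheta (x : R3) : R3 := ![-(x 1) / rr x, x 0 / rr x, 0]
/-- vertical unit vector -/
def ez : R3 := ![0, 0, 1]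

/-- Euclidean dot product on `ℝ³` -/
def dot (a b : R3) : ℝ := ∑ j : Fin 3, a j * b j

/-- azimuthal cylindrical component `v_θ = v · e_θ` -/
def compTh (v : R3 → R3) : R3 → ℝ := fun y => dot (v y) (etheta y)


/-! ### helper lemmas -/

lemma aux_U_iff (x : R3) : x ∈ U ↔ 0 < x 0 ^ 2 + x 1 ^ 2 := by
  simp [U, rr]

lemma aux_U_open : IsOpen U := by
  have : U = {x : R3 | 0 < x 0 ^ 2 + x 1 ^ 2} := by
    ext x; exact aux_U_iff x
  rw [this]
  exact isOpen_lt (by fun_prop) (by fun_prop)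

lemma aux_pd_smooth {u : R3 → ℝ} {x : R3} (i : Fin 3) (hu : ContDiffAt ℝ (⊤ : ℕ∞) u x) :
    ContDiffAt ℝ (⊤ : ℕ∞) (pd i u) x := by
  have h : ContDiffAt ℝ (⊤ : ℕ∞) (fderiv ℝ u) x := hu.fderiv_right (by simp)
  exact h.clm_apply contDiffAt_const

lemma aux_da {u : R3 → ℝ} {x : R3} (hu : ContDiffAt ℝ (⊤ : ℕ∞) u x) :
    DifferentiableAt ℝ u x := hu.differentiableAt (by simp)

lemma aux_pd_congr {u w : R3 → ℝ} {x : R3} (i : Fin 3) (h : u =ᶠ[nhds x] w) :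
    pd i u x = pd i w x := by
  simp only [pd, h.fderiv_eq]

lemma aux_pd_mul {u w : R3 → ℝ} {x : R3} (i : Fin 3) (hu : DifferentiableAt ℝ u x)
    (hw : DifferentiableAt ℝ w x) :
    pd i (fun y => u y * w y) x = pd i u x * w x + u x * pd i w x := by
  simp only [pd]
  rw [fderiv_fun_mul hu hw]
  simp
  ring

lemma aux_pd_add {u w : R3 → ℝ} {x : R3} (i : Fin 3) (hu : DifferentiableAt ℝ u x)
    (hw : DifferentiableAt ℝ w x) :
    pd i (fun y => u y + w y) x = pd i u x + pd i w x := by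
  simp only [pd]
  rw [fderiv_fun_add hu hw]
  simp

lemma aux_pd_sub {u w : R3 → ℝ} {x : R3} (i : Fin 3) (hu : DifferentiableAt ℝ u x)
    (hw : DifferentiableAt ℝ w x) :
    pd i (fun y => u y - w y) x = pd i u x - pd i w x := by
  simp only [pd]
  rw [fderiv_fun_sub hu hw]
  simp

lemma aux_pd_coord (i k : Fin 3) (x : R3) :
    pd i (fun y => y k) x = (Pi.single i 1 : R3) k := by
  simp only [pd]
  have := (hasFDerivAt_apply (𝕜 := ℝ) (F' := fun _ : Fin 3 => ℝ) k x).fderiv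
  rw [this]
  rfl

lemma aux_coord_smooth (k : Fin 3) (x : R3) :
    ContDiffAt ℝ (⊤ : ℕ∞) (fun y : R3 => y k) x := by fun_prop

lemma aux_pd_comm {u : R3 → ℝ} {x : R3} (i j : Fin 3) (hu : ContDiffAt ℝ (⊤ : ℕ∞) u x) :
    pd i (pd j u) x = pd j (pd i u) x := by
  have hs : IsSymmSndFDerivAt ℝ u x := hu.isSymmSndFDerivAt (by
    simp only [minSmoothness_of_isRCLikeNormedField]; exact WithTop.coe_le_coe.2 (le_top : (2 : ℕ∞) ≤ ⊤))
  have hd : DifferentiableAt ℝ (fderiv ℝ u) x :=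
    (hu.fderiv_right (m := (⊤ : ℕ∞)) (by simp)).differentiableAt (by simp)
  have key : ∀ a b : Fin 3, pd a (pd b u) x
      = fderiv ℝ (fderiv ℝ u) x (Pi.single a 1) (Pi.single b 1) := by
    intro a b
    change fderiv ℝ (fun y => fderiv ℝ u y (Pi.single b 1)) x (Pi.single a 1) = _
    rw [fderiv_clm_apply hd (differentiableAt_const _)]
    simp
  rw [key, key]
  exact hs _ _

/-- the horizontal Euler operator -/
def eul (u : R3 → ℝ) : R3 → ℝ := fun x => x 0 * pd 0 u x + x 1 * pd 1 u x

lemma aux_eul_smooth {u : R3 → ℝ} {x : R3} (hu : ContDiffAt ℝ (⊤ : ℕ∞) u x) :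
    ContDiffAt ℝ (⊤ : ℕ∞) (eul u) x :=
  ((aux_coord_smooth 0 x).mul (aux_pd_smooth 0 hu)).add
    ((aux_coord_smooth 1 x).mul (aux_pd_smooth 1 hu))

lemma aux_dTheta_smooth {u : R3 → ℝ} {x : R3} (hu : ContDiffAt ℝ (⊤ : ℕ∞) u x) :
    ContDiffAt ℝ (⊤ : ℕ∞) (dTheta u) x :=
  ((aux_coord_smooth 0 x).mul (aux_pd_smooth 1 hu)).sub
    ((aux_coord_smooth 1 x).mul (aux_pd_smooth 0 hu))

lemma aux_comm {u : R3 → ℝ} {x : R3} (hu : ContDiffAt ℝ (⊤ : ℕ∞) u x) :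
    eul (dTheta u) x = dTheta (eul u) x := by
  have c0 := aux_da (aux_coord_smooth 0 x)
  have c1 := aux_da (aux_coord_smooth 1 x)
  have d0 := aux_da (aux_pd_smooth 0 hu)
  have d1 := aux_da (aux_pd_smooth 1 hu)
  have e1 : ∀ i, pd i (dTheta u) x = _ := fun i =>
    aux_pd_sub (u := fun y => y 0 * pd 1 u y) (w := fun y => y 1 * pd 0 u y) i
      (c0.mul d1) (c1.mul d0)
  have e2 : ∀ i, pd i (eul u) x = _ := fun i =>
    aux_pd_add (u := fun y => y 0 * pd 0 u y) (w := fun y => y 1 * pd 1 u y) i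
      (c0.mul d0) (c1.mul d1)
  have hc := aux_pd_comm 0 1 hu
  have l : eul (dTheta u) x = x 0 * pd 0 (dTheta u) x + x 1 * pd 1 (dTheta u) x := rfl
  have r : dTheta (eul u) x = x 0 * pd 1 (eul u) x - x 1 * pd 0 (eul u) x := rfl
  rw [l, r]
  simp only [e1, e2, aux_pd_mul _ c0 d1, aux_pd_mul _ c1 d0, aux_pd_mul _ c0 d0,
    aux_pd_mul _ c1 d1, aux_pd_coord, hc]
  simp
  ring

lemma aux_dTheta_mul {u w : R3 → ℝ} {x : R3} (hu : DifferentiableAt ℝ u x)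
    (hw : DifferentiableAt ℝ w x) :
    dTheta (fun y => u y * w y) x = dTheta u x * w x + u x * dTheta w x := by
  simp only [dTheta, aux_pd_mul _ hu hw]
  ring

lemma aux_dTheta_rad (φ : ℝ → ℝ) (x : R3) (hφ : DifferentiableAt ℝ φ (x 0 ^ 2 + x 1 ^ 2)) :
    dTheta (fun y => φ (y 0 ^ 2 + y 1 ^ 2)) x = 0 := by
  have hp : ∀ k : Fin 3, HasFDerivAt (fun y : R3 => y k)
      (ContinuousLinearMap.proj (R := ℝ) (φ := fun _ : Fin 3 => ℝ) k) x := fun k =>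
    hasFDerivAt_apply (𝕜 := ℝ) (F' := fun _ : Fin 3 => ℝ) k x
  have h := hφ.hasDerivAt.comp_hasFDerivAt x (((hp 0).pow 2).add ((hp 1).pow 2))
  have h2 := h.fderiv
  have h3 : fderiv ℝ (fun y : R3 => φ (y 0 ^ 2 + y 1 ^ 2)) x = _ := h2
  simp only [dTheta, pd, h3]
  simp
  ring

lemma aux_int_pd (i : Fin 3) (F : R3 → ℝ) (hF : ContDiff ℝ (⊤ : ℕ∞) F)
    (hc : HasCompactSupport F) : ∫ x, pd i F x = 0 := by
  have hd : Differentiable ℝ F := hF.differentiable (by simp)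
  have hcont : Continuous (pd i F) :=
    continuous_iff_continuousAt.2 fun x => (aux_pd_smooth i hF.contDiffAt).continuousAt
  have hcs : HasCompactSupport (pd i F) := hc.fderiv_apply ℝ _
  have := integral_mul_fderiv_eq_neg_fderiv_mul_of_integrable (μ := (volume : Measure R3))
    (f := fun _ : R3 => (1 : ℝ)) (g := F) (v := Pi.single i 1) (by simp)
    (by simp only [one_mul]; exact hcont.integrable_of_hasCompactSupport hcs)
    (by simpa using hF.continuous.integrable_of_hasCompactSupport hc)
    (by fun_prop) (fun x _ => hd x)
  simpa [pd] using this

lemma aux_pd_integrable (i : Fin 3) (F : R3 → ℝ) (hF : ContDiff ℝ (⊤ : ℕ∞) F)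
    (hc : HasCompactSupport F) : Integrable (pd i F) := by
  have hcont : Continuous (pd i F) :=
    continuous_iff_continuousAt.2 fun x => (aux_pd_smooth i hF.contDiffAt).continuousAt
  exact hcont.integrable_of_hasCompactSupport (hc.fderiv_apply ℝ _)

lemma aux_int_dTheta (F : R3 → ℝ) (hF : ContDiff ℝ (⊤ : ℕ∞) F)
    (hc : HasCompactSupport F) : ∫ x, dTheta F x = 0 := by
  have hd : Differentiable ℝ F := hF.differentiable (by simp)
  have s : ∀ k : Fin 3, ContDiff ℝ (⊤ : ℕ∞) (fun y : R3 => y k * F y) := fun k => by fun_prop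
  have c : ∀ k : Fin 3, HasCompactSupport (fun y : R3 => y k * F y) := fun k =>
    hc.mul_left (f := fun y : R3 => y k)
  have e : dTheta F = fun x => pd 1 (fun y : R3 => y 0 * F y) x
      - pd 0 (fun y : R3 => y 1 * F y) x := by
    ext x
    rw [aux_pd_mul 1 (aux_da (aux_coord_smooth 0 x)) (hd x),
      aux_pd_mul 0 (aux_da (aux_coord_smooth 1 x)) (hd x), aux_pd_coord, aux_pd_coord]
    simp [dTheta]
  rw [e, integral_sub (aux_pd_integrable _ _ (s 0) (c 0)) (aux_pd_integrable _ _ (s 1) (c 1)),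
    aux_int_pd _ _ (s 0) (c 0), aux_int_pd _ _ (s 1) (c 1), sub_zero]

lemma aux_contDiff_tsupport {F : R3 → ℝ} (h : ∀ x ∈ tsupport F, ContDiffAt ℝ (⊤ : ℕ∞) F x) :
    ContDiff ℝ (⊤ : ℕ∞) F := by
  rw [contDiff_iff_contDiffAt]
  intro x
  by_cases hx : x ∈ tsupport F
  · exact h x hx
  · exact (contDiffAt_const (c := (0 : ℝ))).congr_of_eventuallyEq
      (notMem_tsupport_iff_eventuallyEq.1 hx)

lemma aux_rinv_smooth {x : R3} (hx : x ∈ U) : ContDiffAt ℝ (⊤ : ℕ∞) (fun y => (rr y)⁻¹) x := by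
  have h0 : x 0 ^ 2 + x 1 ^ 2 ≠ 0 := ((aux_U_iff x).1 hx).ne'
  have h1 : ContDiffAt ℝ (⊤ : ℕ∞) rr x := by
    have : ContDiffAt ℝ (⊤ : ℕ∞) (fun y : R3 => y 0 ^ 2 + y 1 ^ 2) x := by fun_prop
    exact this.sqrt h0
  exact h1.inv (ne_of_gt hx)

lemma aux_compTh_smooth {v : R3 → R3} (hv : ContDiff ℝ (⊤ : ℕ∞) v) {x : R3} (hx : x ∈ U) :
    ContDiffAt ℝ (⊤ : ℕ∞) (compTh v) x := by
  have h := aux_rinv_smooth hx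
  have hv' : ∀ k, ContDiffAt ℝ (⊤ : ℕ∞) (fun y => v y k) x := fun k =>
    (contDiff_pi.1 hv k).contDiffAt
  have e : compTh v = fun y => v y 0 * (-(y 1) * (rr y)⁻¹) + v y 1 * (y 0 * (rr y)⁻¹) := by
    ext y
    simp [compTh, dot, etheta, Fin.sum_univ_three, div_eq_mul_inv]
  rw [e]
  exact ((hv' 0).mul ((aux_coord_smooth 1 x).neg.mul h)).add
    ((hv' 1).mul ((aux_coord_smooth 0 x).mul h))

lemma aux_dTheta_rinv {x : R3} (hx : x ∈ U) : dTheta (fun y => (rr y)⁻¹) x = 0 := by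
  have h0 := (aux_U_iff x).1 hx
  exact aux_dTheta_rad (fun t => (Real.sqrt t)⁻¹) x
    ((Real.hasDerivAt_sqrt h0.ne').differentiableAt.inv (Real.sqrt_pos.2 h0).ne')

/-- the summed integral
`Σ_{i=1,2} ∫ ℋ ∂_{x_i}((1/r)∂_θ v_θ) ∂_{x_i}ℋ dx` vanishes for smooth compactly
supported axisymmetric `ℋ` (with support in `U`) and smooth `v`. -/
theorem stmt_18 (H : R3 → ℝ) (hH : ContDiff ℝ (⊤ : ℕ∞) H) (hHc : HasCompactSupport H)
    (hsupp : tsupport H ⊆ U) (hax : axisym H)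
    (v : R3 → R3) (hv : ContDiff ℝ (⊤ : ℕ∞) v) :
    (∫ x : R3, H x * pd 0 (fun y => dTheta (compTh v) y / rr y) x * pd 0 H x)
      + (∫ x : R3, H x * pd 1 (fun y => dTheta (compTh v) y / rr y) x * pd 1 H x)
      = 0 := by
  set g : R3 → ℝ := fun y => dTheta (compTh v) y / rr y with hg
  set G : R3 → ℝ := fun y => compTh v y * (rr y)⁻¹ with hG
  have hGs : ∀ x ∈ U, ContDiffAt ℝ (⊤ : ℕ∞) G x := fun x hx =>
    (aux_compTh_smooth hv hx).mul (aux_rinv_smooth hx)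
  have hgG : ∀ x ∈ U, g x = dTheta G x := by
    intro x hx
    rw [hG, aux_dTheta_mul (aux_da (aux_compTh_smooth hv hx)) (aux_da (aux_rinv_smooth hx)),
      aux_dTheta_rinv hx, hg]
    simp [div_eq_mul_inv]
  have hgs : ∀ x ∈ U, ContDiffAt ℝ (⊤ : ℕ∞) g x := fun x hx =>
    (aux_dTheta_smooth (aux_compTh_smooth hv hx)).mul (aux_rinv_smooth hx)
  -- integrability
  have hint : ∀ i : Fin 3, Integrable (fun x => H x * pd i g x * pd i H x) := by
    intro i
    have hsub : tsupport (fun x => H x * (pd i g x * pd i H x)) ⊆ tsupport H :=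
      tsupport_mul_subset_left (f := H) (g := fun x => pd i g x * pd i H x)
    have hs : ContDiff ℝ (⊤ : ℕ∞) (fun x => H x * (pd i g x * pd i H x)) :=
      aux_contDiff_tsupport fun x hx => hH.contDiffAt.mul
        ((aux_pd_smooth i (hgs x (hsupp (hsub hx)))).mul (aux_pd_smooth i hH.contDiffAt))
    have hc : HasCompactSupport (fun x => H x * (pd i g x * pd i H x)) :=
      hHc.mul_right (f' := fun x => pd i g x * pd i H x)
    simpa only [mul_assoc] using hs.continuous.integrable_of_hasCompactSupport hc
  rw [← integral_add (hint 0) (hint 1)]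
  set K : R3 → ℝ := fun x => eul H x * ((x 0 ^ 2 + x 1 ^ 2)⁻¹ * eul G x) with hK
  have hρ : ∀ x ∈ U, ContDiffAt ℝ (⊤ : ℕ∞) (fun y : R3 => (y 0 ^ 2 + y 1 ^ 2)⁻¹) x := by
    intro x hx
    have : ContDiffAt ℝ (⊤ : ℕ∞) (fun y : R3 => y 0 ^ 2 + y 1 ^ 2) x := by fun_prop
    exact this.inv ((aux_U_iff x).1 hx).ne'
  have hρG : ∀ x ∈ U, ContDiffAt ℝ (⊤ : ℕ∞)
      (fun y : R3 => (y 0 ^ 2 + y 1 ^ 2)⁻¹ * eul G y) x := fun x hx =>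
    (hρ x hx).mul (aux_eul_smooth (hGs x hx))
  have hKs : ∀ x ∈ U, ContDiffAt ℝ (⊤ : ℕ∞) K x := fun x hx =>
    (aux_eul_smooth hH.contDiffAt).mul (hρG x hx)
  have hsub : tsupport (fun x => H x * K x) ⊆ tsupport H :=
    tsupport_mul_subset_left (f := H) (g := K)
  have hFs : ContDiff ℝ (⊤ : ℕ∞) (fun x => H x * K x) :=
    aux_contDiff_tsupport fun x hx => hH.contDiffAt.mul (hKs x (hsupp (hsub hx)))
  have hFc : HasCompactSupport (fun x => H x * K x) := hHc.mul_right (f' := K)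
  rw [← aux_int_dTheta _ hFs hFc]
  congr 1
  ext x
  by_cases hx : x ∈ U
  · have hnhds : ∀ᶠ y in nhds x, y ∈ U := aux_U_open.mem_nhds hx
    have h0 := ((aux_U_iff x).1 hx).ne'
    have hgx : ∀ i, pd i g x = pd i (dTheta G) x := fun i =>
      aux_pd_congr i (hnhds.mono hgG)
    have hH0 : dTheta H x = 0 := hax x hx
    have hHz : ∀ i, pd i (dTheta H) x = 0 := fun i => by
      rw [aux_pd_congr (w := fun _ => 0) i (hnhds.mono hax)]
      simp [pd]
    have hEH : dTheta (eul H) x = 0 := by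
      rw [← aux_comm hH.contDiffAt]
      simp [eul, hHz]
    have hr : dTheta (fun y : R3 => (y 0 ^ 2 + y 1 ^ 2)⁻¹) x = 0 :=
      aux_dTheta_rad (fun t => t⁻¹) x (differentiableAt_inv h0)
    rw [aux_dTheta_mul (aux_da hH.contDiffAt) (aux_da (hKs x hx)), hK,
      aux_dTheta_mul (aux_da (aux_eul_smooth hH.contDiffAt)) (aux_da (hρG x hx)),
      aux_dTheta_mul (aux_da (hρ x hx)) (aux_da (aux_eul_smooth (hGs x hx))),
      hH0, hEH, hr, ← aux_comm (hGs x hx), hgx, hgx]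
    simp only [eul]
    simp only [dTheta] at hH0
    field_simp
    generalize pd 0 (dTheta G) x = a
    generalize pd 1 (dTheta G) x = b
    linear_combination (H x) * (b * x 0 - a * x 1) * hH0
  · have hx' : x ∉ tsupport H := fun h => hx (hsupp h)
    have hx2 : x ∉ tsupport (fun x => H x * K x) := fun h => hx' (hsub h)
    have e := notMem_tsupport_iff_eventuallyEq.1 hx2
    have hz : ∀ i, pd i (fun x => H x * K x) x = 0 := fun i => by
      rw [aux_pd_congr i e]
      simp [pd]
    have : H x = 0 := image_eq_zero_of_notMem_tsupport hx'
    simp [dTheta, hz, this]
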